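/- Let Υ be the 2-form Υ = u¹ du²∧du³ + u² du³∧du¹ − 2u³ du¹∧du² on ℝ³ and set Ω = (Υ, 0, 0). Then there is no solution of the prescribed-derived-coframing problem near the origin: there do not exist an open neighborhood U ⊆ ℝ³ of 0, a smooth map x : U → ℝ³ with Dx(u) invertible for all u ∈ U, and a smooth map a : U → SO(3), such that the matrix W(u) = a(u)⁻¹ · Dx(u) satisfies the nine equations dω = Ω, namely: for i ∈ {2,3}, ∂_j W_{ik} = ∂_k W_{ij} for all j,k; and ∂₂W_{13} − ∂₃W_{12} = u¹, ∂₃W_{11} − ∂₁W_{13} = u², ∂₁W_{12} − ∂₂W_{11} = −2u³ on U. -/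

import Mathlib

open Matrix

noncomputable section

/-- Partial derivative in the `j`-th coordinate direction. -/
def pd {m : ℕ} {F : Type*} [NormedAddCommGroup F] [NormedSpace ℝ F]
    (j : Fin m) (f : (Fin m → ℝ) → F) (u : Fin m → ℝ) : F :=
  fderiv ℝ f u (Pi.single j 1)

/-- The special orthogonal group SO(3), as a set of 3×3 real matrices. -/
def SO3 : Set (Matrix (Fin 3) (Fin 3) ℝ) :=
  {A | Aᵀ * A = 1 ∧ A.det = 1}

/-- The skew-symmetric matrix `[v]` associated to `v ∈ ℝ³`, with `[v] w = w × v`. -/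
def crossMat (v : Fin 3 → ℝ) : Matrix (Fin 3) (Fin 3) ℝ :=
  !![0, v 2, -(v 1); -(v 2), 0, v 0; v 1, -(v 0), 0]

/-- The Jacobian matrix of a map `x : ℝ³ → ℝ³`. -/
def jacobian (x : (Fin 3 → ℝ) → (Fin 3 → ℝ)) (u : Fin 3 → ℝ) :
    Matrix (Fin 3) (Fin 3) ℝ :=
  Matrix.of fun i j => pd j x u i

/-- `W(u) = a(u)⁻¹ · Dx(u)`, the coefficient matrix of the coframing `ω = a⁻¹ dx`. -/
def Wmat (a : (Fin 3 → ℝ) → Matrix (Fin 3) (Fin 3) ℝ)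
    (x : (Fin 3 → ℝ) → (Fin 3 → ℝ)) (u : Fin 3 → ℝ) : Matrix (Fin 3) (Fin 3) ℝ :=
  (a u)⁻¹ * jacobian x u

/-- The tableau `A_Q`: the span of the matrices `[x] + [y] Q`. -/
def tableau (Q : Matrix (Fin 3) (Fin 3) ℝ) : Submodule ℝ (Matrix (Fin 3) (Fin 3) ℝ) :=
  Submodule.span ℝ {M | ∃ x y : Fin 3 → ℝ, M = crossMat x + crossMat y * Q}

end


namespace Upsilon

def det3 (p q r : Fin 3 → ℝ) : ℝ :=
  p 0 * (q 1 * r 2 - q 2 * r 1) + p 1 * (q 2 * r 0 - q 0 * r 2) + p 2 * (q 0 * r 1 - q 1 * r 0)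

lemma cramer {p q r : Fin 3 → ℝ} (h : det3 p q r ≠ 0) (A : Fin 3 → ℝ) :
    ∃ x y z : ℝ, ∀ j, A j = x * p j + y * q j + z * r j := by
  refine ⟨det3 A q r / det3 p q r, det3 p A r / det3 p q r, det3 p q A / det3 p q r, ?_⟩
  intro j
  field_simp
  fin_cases j <;> simp only [det3] <;> simp <;> ring

lemma alg {A B C p q r v : Fin 3 → ℝ} (hd : det3 p q r ≠ 0)
    (h1 : ∀ j k, A j * p k - A k * p j = C j * r k - C k * r j)
    (h2 : ∀ j k, B j * p k - B k * p j + (C j * q k - C k * q j) = 0)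
    (hv0 : - (A 1 * q 2 - A 2 * q 1) - (B 1 * r 2 - B 2 * r 1) = v 0)
    (hv1 : - (A 2 * q 0 - A 0 * q 2) - (B 2 * r 0 - B 0 * r 2) = v 1)
    (hv2 : - (A 0 * q 1 - A 1 * q 0) - (B 0 * r 1 - B 1 * r 0) = v 2) :
    (∀ j k, C j * p k - C k * p j = 0) ∧
    (det3 A B p = C 0 * v 0 + C 1 * v 1 + C 2 * v 2 →
      p 0 * v 0 + p 1 * v 1 + p 2 * v 2 = 0) := by
  obtain ⟨a0, a1, a2, hA⟩ := cramer hd A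
  obtain ⟨b0, b1, b2, hB⟩ := cramer hd B
  obtain ⟨c0, c1, c2, hC⟩ := cramer hd C
  have e1 := h1 1 2
  have e2 := h1 2 0
  have e3 := h1 0 1
  have f1 := h2 1 2
  have f2 := h2 2 0
  have f3 := h2 0 1
  simp only [hA, hB, hC] at e1 e2 e3 f1 f2 f3 hv0 hv1 hv2
  have C1 : c1 = 0 := by
    apply mul_right_cancel₀ hd
    unfold det3
    linear_combination -(p 0 * e1 + p 1 * e2 + p 2 * e3)
  have C2 : c2 = 0 := by
    apply mul_right_cancel₀ hd
    unfold det3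
    linear_combination -(p 0 * f1 + p 1 * f2 + p 2 * f3)
  have A1 : a1 = 0 := by
    apply mul_right_cancel₀ hd
    unfold det3
    linear_combination -(r 0 * e1 + r 1 * e2 + r 2 * e3)
  have A2 : a2 = -c0 := by
    apply mul_right_cancel₀ hd
    unfold det3
    linear_combination (q 0 * e1 + q 1 * e2 + q 2 * e3)
  have B2 : b2 = 0 := by
    apply mul_right_cancel₀ hd
    unfold det3
    linear_combination (q 0 * f1 + q 1 * f2 + q 2 * f3)
  have B1 : b1 = c0 := by
    apply mul_right_cancel₀ hd
    unfold det3
    linear_combination -(r 0 * f1 + r 1 * f2 + r 2 * f3)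
  subst C1 C2 A1 A2 B2 B1
  refine ⟨fun j k => by rw [hC j, hC k]; ring, fun h => ?_⟩
  have hpv : p 0 * v 0 + p 1 * v 1 + p 2 * v 2 = -2 * b1 * det3 p q r := by
    rw [← hv0, ← hv1, ← hv2]; unfold det3; ring
  have h3 : det3 A B p = b1 ^ 2 * det3 p q r := by
    simp only [det3, hA, hB]; ring
  have h4 : 3 * b1 ^ 2 * det3 p q r = 0 := by
    rw [h3] at h
    simp only [hC] at h
    linear_combination h + b1 * hpv
  have h5 : b1 = 0 := by
    rcases mul_eq_zero.1 h4 with h | h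
    · simpa using h
    · exact absurd h hd
  rw [hpv, h5]; ring

abbrev Sm (f : (Fin 3 → ℝ) → ℝ) (u : Fin 3 → ℝ) : Prop := ContDiffAt ℝ (⊤ : ℕ∞) f u

lemma Sm.d {f : (Fin 3 → ℝ) → ℝ} {u} (h : Sm f u) : DifferentiableAt ℝ f u :=
  h.differentiableAt (by simp)

lemma Sm.pd {f : (Fin 3 → ℝ) → ℝ} {u} (h : Sm f u) (j : Fin 3) : Sm (pd j f) u := by
  have h1 : ContDiffAt ℝ (⊤ : ℕ∞) (fderiv ℝ f) u := h.fderiv_right (by simp)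
  exact h1.clm_apply contDiffAt_const

lemma pd_mul {f g : (Fin 3 → ℝ) → ℝ} {u} (hf : Sm f u) (hg : Sm g u) (j : Fin 3) :
    pd j (fun v => f v * g v) u = pd j f u * g u + f u * pd j g u := by
  unfold _root_.pd
  rw [fderiv_fun_mul hf.d hg.d]
  simp; ring

lemma pd_add {f g : (Fin 3 → ℝ) → ℝ} {u} (hf : Sm f u) (hg : Sm g u) (j : Fin 3) :
    pd j (fun v => f v + g v) u = pd j f u + pd j g u := by
  unfold _root_.pd
  rw [fderiv_fun_add hf.d hg.d]
  simp

lemma pd_sub {f g : (Fin 3 → ℝ) → ℝ} {u} (hf : Sm f u) (hg : Sm g u) (j : Fin 3) :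
    pd j (fun v => f v - g v) u = pd j f u - pd j g u := by
  unfold _root_.pd
  rw [fderiv_fun_sub hf.d hg.d]
  simp

lemma pd_comm {f : (Fin 3 → ℝ) → ℝ} {u} (hf : Sm f u) (j k : Fin 3) :
    pd j (pd k f) u = pd k (pd j f) u := by
  have h1 : ContDiffAt ℝ (⊤ : ℕ∞) (fderiv ℝ f) u := hf.fderiv_right (by simp)
  have h2 : DifferentiableAt ℝ (fderiv ℝ f) u := h1.differentiableAt (by simp)
  have key : ∀ j k : Fin 3, pd j (pd k f) u
      = fderiv ℝ (fderiv ℝ f) u (Pi.single j 1) (Pi.single k 1) := by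
    intro j k
    change fderiv ℝ (fun v => fderiv ℝ f v (Pi.single k 1)) u (Pi.single j 1) = _
    rw [fderiv_clm_apply h2 (differentiableAt_const _)]
    simp
  rw [key, key]
  exact (hf.isSymmSndFDerivAt (by simp; exact WithTop.coe_le_coe.2 le_top)) _ _

lemma pd_congr {f g : (Fin 3 → ℝ) → ℝ} {U : Set (Fin 3 → ℝ)} (hU : IsOpen U) {u}
    (hu : u ∈ U) (h : ∀ v ∈ U, f v = g v) (j : Fin 3) : pd j f u = pd j g u := by
  unfold _root_.pd
  rw [Filter.EventuallyEq.fderiv_eq (Filter.eventuallyEq_of_mem (hU.mem_nhds hu) h)]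

lemma pd_const (c : ℝ) (u) (j : Fin 3) : pd j (fun _ : Fin 3 → ℝ => c) u = 0 := by
  unfold _root_.pd; simp

lemma pd_coord (i j : Fin 3) (u) : pd j (fun v : Fin 3 → ℝ => v i) u = if i = j then 1 else 0 := by
  have : fderiv ℝ (fun v : Fin 3 → ℝ => v i) u = ContinuousLinearMap.proj i :=
    (ContinuousLinearMap.proj (R := ℝ) (φ := fun _ : Fin 3 => ℝ) i).fderiv
  unfold _root_.pd
  rw [this]; simp [Pi.single_apply]

lemma pd_dot {f g : Fin 3 → (Fin 3 → ℝ) → ℝ} {u} (hf : ∀ m, Sm (f m) u) (hg : ∀ m, Sm (g m) u)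
    (j : Fin 3) :
    pd j (fun v => f 0 v * g 0 v + f 1 v * g 1 v + f 2 v * g 2 v) u =
      (pd j (f 0) u * g 0 u + f 0 u * pd j (g 0) u) +
      (pd j (f 1) u * g 1 u + f 1 u * pd j (g 1) u) +
      (pd j (f 2) u * g 2 u + f 2 u * pd j (g 2) u) := by
  have s := fun m => ContDiffAt.mul (hf m) (hg m)
  rw [pd_add (f := fun v => f 0 v * g 0 v + f 1 v * g 1 v) (g := fun v => f 2 v * g 2 v)
    ((s 0).add (s 1)) (s 2), pd_add (f := fun v => f 0 v * g 0 v) (g := fun v => f 1 v * g 1 v)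
    (s 0) (s 1), pd_mul (hf 0) (hg 0), pd_mul (hf 1) (hg 1), pd_mul (hf 2) (hg 2)]

/-- dot product of two triples of functions -/
def dt (f g : Fin 3 → (Fin 3 → ℝ) → ℝ) (v : Fin 3 → ℝ) : ℝ :=
  f 0 v * g 0 v + f 1 v * g 1 v + f 2 v * g 2 v

lemma Sm.dt {f g : Fin 3 → (Fin 3 → ℝ) → ℝ} {u} (hf : ∀ m, Sm (f m) u) (hg : ∀ m, Sm (g m) u) :
    Sm (dt f g) u := by
  have s := fun m => ContDiffAt.mul (hf m) (hg m)
  exact ((s 0).add (s 1)).add (s 2)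

lemma pd_dt {f g : Fin 3 → (Fin 3 → ℝ) → ℝ} {u} (hf : ∀ m, Sm (f m) u) (hg : ∀ m, Sm (g m) u)
    (j : Fin 3) :
    pd j (dt f g) u = dt (fun m => pd j (f m)) g u + dt f (fun m => pd j (g m)) u := by
  unfold Upsilon.dt
  rw [pd_dot hf hg]; ring

/-- Parseval: if the columns `b l` are orthonormal, then dot products may be expanded. -/
lemma parseval {b : Fin 3 → Fin 3 → (Fin 3 → ℝ) → ℝ} {u}
    (hb : ∀ m n, b 0 m u * b 0 n u + b 1 m u * b 1 n u + b 2 m u * b 2 n u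
      = if m = n then 1 else 0) (f g : Fin 3 → (Fin 3 → ℝ) → ℝ) :
    dt f g u = dt (b 0) f u * dt (b 0) g u + dt (b 1) f u * dt (b 1) g u
      + dt (b 2) f u * dt (b 2) g u := by
  have h00 := hb 0 0
  have h01 := hb 0 1
  have h02 := hb 0 2
  have h11 := hb 1 1
  have h12 := hb 1 2
  have h22 := hb 2 2
  simp at h00 h01 h02 h11 h12 h22
  unfold dt
  linear_combination -(f 0 u * g 0 u) * h00 - (f 1 u * g 1 u) * h11 - (f 2 u * g 2 u) * h22
    - (f 0 u * g 1 u + f 1 u * g 0 u) * h01 - (f 0 u * g 2 u + f 2 u * g 0 u) * h02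
    - (f 1 u * g 2 u + f 2 u * g 1 u) * h12

lemma core {U : Set (Fin 3 → ℝ)} (hU : IsOpen U) {X : Fin 3 → (Fin 3 → ℝ) → ℝ}
    {b : Fin 3 → Fin 3 → (Fin 3 → ℝ) → ℝ}
    (hX : ∀ u ∈ U, ∀ m, Sm (X m) u) (hb : ∀ u ∈ U, ∀ l m, Sm (b l m) u)
    (ho : ∀ u ∈ U, ∀ k l, dt (b k) (b l) u = if k = l then 1 else 0)
    (ho' : ∀ u ∈ U, ∀ m n, b 0 m u * b 0 n u + b 1 m u * b 1 n u + b 2 m u * b 2 n u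
      = if m = n then 1 else 0)
    (w : Fin 3 → Fin 3 → (Fin 3 → ℝ) → ℝ)
    (hw : ∀ i k, w i k = dt (b i) (fun m => pd k (X m)))
    (hd : ∀ u ∈ U, det3 (fun k => w 0 k u) (fun k => w 1 k u) (fun k => w 2 k u) ≠ 0)
    (h1 : ∀ u ∈ U, ∀ j k, pd j (w 1 k) u = pd k (w 1 j) u)
    (h2 : ∀ u ∈ U, ∀ j k, pd j (w 2 k) u = pd k (w 2 j) u)
    (v : Fin 3 → (Fin 3 → ℝ) → ℝ)
    (hv0 : ∀ u ∈ U, pd 1 (w 0 2) u - pd 2 (w 0 1) u = v 0 u)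
    (hv1 : ∀ u ∈ U, pd 2 (w 0 0) u - pd 0 (w 0 2) u = v 1 u)
    (hv2 : ∀ u ∈ U, pd 0 (w 0 1) u - pd 1 (w 0 0) u = v 2 u) :
    ∀ u ∈ U, w 0 0 u * v 0 u + w 0 1 u * v 1 u + w 0 2 u * v 2 u = 0 := by
  -- connection forms
  let θ : Fin 3 → Fin 3 → Fin 3 → (Fin 3 → ℝ) → ℝ :=
    fun k l j => dt (b k) (fun m => pd j (b l m))
  have dtc : ∀ f g u, dt f g u = dt g f u := by intro f g u; unfold dt; ring
  have skew : ∀ u ∈ U, ∀ k l j, θ k l j u = - θ l k j u := by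
    intro u hu k l j
    have h := pd_congr hU hu (fun v hv => ho v hv k l) j
    have h' : pd j (dt (b k) (b l)) u = 0 := h.trans (pd_const _ _ _)
    rw [pd_dt (hb u hu k) (hb u hu l), dtc (fun m => pd j (b k m))] at h'
    change θ l k j u + θ k l j u = 0 at h'
    linarith
  have diag : ∀ u ∈ U, ∀ k j, θ k k j u = 0 := by
    intro u hu k j
    have := skew u hu k k j
    linarith
  have sw : ∀ u ∈ U, ∀ i k, Sm (w i k) u := by
    intro u hu i k
    rw [hw]
    exact Sm.dt (hb u hu i) (fun m => (hX u hu m).pd k)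
  have sθ : ∀ u ∈ U, ∀ k l j, Sm (θ k l j) u := by
    intro u hu k l j
    exact Sm.dt (hb u hu k) (fun m => (hb u hu l m).pd j)
  have curl : ∀ u ∈ U, ∀ i j k, pd j (w i k) u - pd k (w i j) u =
      (θ 0 i j u * w 0 k u + θ 1 i j u * w 1 k u + θ 2 i j u * w 2 k u) -
      (θ 0 i k u * w 0 j u + θ 1 i k u * w 1 j u + θ 2 i k u * w 2 j u) := by
    intro u hu i j k
    have e : ∀ j k, pd j (w i k) u =
        (θ 0 i j u * w 0 k u + θ 1 i j u * w 1 k u + θ 2 i j u * w 2 k u) +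
          dt (b i) (fun m => pd j (pd k (X m))) u := by
      intro j k
      rw [hw i k, pd_dt (hb u hu i) (fun m => (hX u hu m).pd k), parseval (ho' u hu)]
      simp only [hw, θ]
    have e2 : dt (b i) (fun m => pd j (pd k (X m))) u
        = dt (b i) (fun m => pd k (pd j (X m))) u := by
      simp only [dt, pd_comm (hX u hu _) j k]
    rw [e j k, e k j, e2]; ring
  have curv : ∀ u ∈ U, ∀ j k, pd j (θ 1 2 k) u - pd k (θ 1 2 j) u =
      θ 0 1 j u * θ 0 2 k u - θ 0 1 k u * θ 0 2 j u := by
    intro u hu j k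
    have e : ∀ j k, pd j (θ 1 2 k) u = θ 0 1 j u * θ 0 2 k u +
          dt (b 1) (fun m => pd j (pd k (b 2 m))) u := by
      intro j k
      change pd j (dt (b 1) (fun m => pd k (b 2 m))) u = _
      rw [pd_dt (hb u hu 1) (fun m => (hb u hu 2 m).pd k), parseval (ho' u hu)]
      change θ 0 1 j u * θ 0 2 k u + θ 1 1 j u * θ 1 2 k u + θ 2 1 j u * θ 2 2 k u + _ = _
      rw [diag u hu 1, diag u hu 2]; ring
    have e2 : dt (b 1) (fun m => pd j (pd k (b 2 m))) u
        = dt (b 1) (fun m => pd k (pd j (b 2 m))) u := by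
      simp only [dt, pd_comm (hb u hu 2 _) j k]
    rw [e j k, e k j, e2]; ring
  have main : ∀ u ∈ U, _ := fun u hu =>
    alg (A := fun j => θ 0 1 j u) (B := fun j => θ 0 2 j u) (C := fun j => θ 1 2 j u)
      (v := fun j => v j u) (hd u hu)
      (by
        intro j k
        have := curl u hu 1 j k
        rw [h1 u hu j k, diag u hu, diag u hu, skew u hu 2 1, skew u hu 2 1] at this
        linarith)
      (by
        intro j k
        have := curl u hu 2 j k
        rw [h2 u hu j k, diag u hu, diag u hu] at this
        linarith)
      (by
        have := curl u hu 0 1 2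
        rw [hv0 u hu, diag u hu, diag u hu, skew u hu 2 0, skew u hu 2 0, skew u hu 1 0,
          skew u hu 1 0] at this
        linarith)
      (by
        have := curl u hu 0 2 0
        rw [hv1 u hu, diag u hu, diag u hu, skew u hu 2 0, skew u hu 2 0, skew u hu 1 0,
          skew u hu 1 0] at this
        linarith)
      (by
        have := curl u hu 0 0 1
        rw [hv2 u hu, diag u hu, diag u hu, skew u hu 2 0, skew u hu 2 0, skew u hu 1 0,
          skew u hu 1 0] at this
        linarith)
  intro u hu
  refine (main u hu).2 ?_
  have dz : ∀ i j k, pd i (θ 1 2 j) u * w 0 k u + θ 1 2 j u * pd i (w 0 k) u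
      - (pd i (θ 1 2 k) u * w 0 j u + θ 1 2 k u * pd i (w 0 j) u) = 0 := by
    intro i j k
    have h := pd_congr hU hu (fun v hv => (main v hv).1 j k) i
    rw [pd_const] at h
    rw [← h, pd_sub (f := fun v => θ 1 2 j v * w 0 k v) (g := fun v => θ 1 2 k v * w 0 j v)
      ((sθ u hu _ _ _).mul (sw u hu _ _)) ((sθ u hu _ _ _).mul (sw u hu _ _)),
      pd_mul (sθ u hu _ _ _) (sw u hu _ _), pd_mul (sθ u hu _ _ _) (sw u hu _ _)]
  have z1 := dz 0 1 2
  have z2 := dz 1 2 0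
  have z3 := dz 2 0 1
  have k1 := curv u hu 1 2
  have k2 := curv u hu 2 0
  have k3 := curv u hu 0 1
  have v0 := hv0 u hu
  have v1 := hv1 u hu
  have v2 := hv2 u hu
  unfold det3
  simp only
  linear_combination z1 + z2 + z3 - w 0 0 u * k1 - w 0 1 u * k2 - w 0 2 u * k3
    + θ 1 2 0 u * v0 + θ 1 2 1 u * v1 + θ 1 2 2 u * v2

end Upsilon

/-- nonexistence of a solution of the prescribed-derived-coframing
problem near the origin for `Ω = (Υ, 0, 0)` with
`Υ = u¹ du²∧du³ + u² du³∧du¹ - 2u³ du¹∧du²` (Example 4.1 of the paper). -/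
theorem no_solution_for_upsilon :
    ¬ ∃ (U : Set (Fin 3 → ℝ)) (x : (Fin 3 → ℝ) → (Fin 3 → ℝ))
        (a : (Fin 3 → ℝ) → Matrix (Fin 3) (Fin 3) ℝ),
      IsOpen U ∧ (0 : Fin 3 → ℝ) ∈ U ∧
      ContDiffOn ℝ (⊤ : ℕ∞) x U ∧
      (∀ u ∈ U, IsUnit (jacobian x u).det) ∧
      (∀ i k : Fin 3, ContDiffOn ℝ (⊤ : ℕ∞) (fun u => a u i k) U) ∧
      (∀ u ∈ U, a u ∈ SO3) ∧
      (∀ i : Fin 3, i = 1 ∨ i = 2 → ∀ j k : Fin 3, ∀ u ∈ U,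
        pd j (fun v => Wmat a x v i k) u = pd k (fun v => Wmat a x v i j) u) ∧
      (∀ u ∈ U,
        pd 1 (fun v => Wmat a x v 0 2) u - pd 2 (fun v => Wmat a x v 0 1) u = u 0 ∧
        pd 2 (fun v => Wmat a x v 0 0) u - pd 0 (fun v => Wmat a x v 0 2) u = u 1 ∧
        pd 0 (fun v => Wmat a x v 0 1) u - pd 1 (fun v => Wmat a x v 0 0) u
          = -2 * u 2) := by
  rintro ⟨U, x, a, hU, h0, hx, hJ, ha, hSO, h12, hv⟩
  let X : Fin 3 → (Fin 3 → ℝ) → ℝ := fun m u => x u m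
  let b : Fin 3 → Fin 3 → (Fin 3 → ℝ) → ℝ := fun l m u => a u m l
  let w : Fin 3 → Fin 3 → (Fin 3 → ℝ) → ℝ :=
    fun i k => Upsilon.dt (b i) (fun m => pd k (X m))
  have hxu : ∀ u ∈ U, ContDiffAt ℝ (⊤ : ℕ∞) x u := fun u hu => hx.contDiffAt (hU.mem_nhds hu)
  have hX : ∀ u ∈ U, ∀ m, Upsilon.Sm (X m) u := fun u hu m => contDiffAt_pi.1 (hxu u hu) m
  have hb : ∀ u ∈ U, ∀ l m, Upsilon.Sm (b l m) u := fun u hu l m =>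
    (ha m l).contDiffAt (hU.mem_nhds hu)
  have ho : ∀ u ∈ U, ∀ k l, Upsilon.dt (b k) (b l) u = if k = l then 1 else 0 := by
    intro u hu k l
    have h := congrFun (congrFun (hSO u hu).1 k) l
    rw [Matrix.mul_apply, Fin.sum_univ_three, Matrix.one_apply] at h
    exact h
  have ho' : ∀ u ∈ U, ∀ m n, b 0 m u * b 0 n u + b 1 m u * b 1 n u + b 2 m u * b 2 n u
      = if m = n then 1 else 0 := by
    intro u hu m n
    have h' : a u * (a u)ᵀ = 1 := mul_eq_one_comm.1 (hSO u hu).1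
    have h := congrFun (congrFun h' m) n
    rw [Matrix.mul_apply, Fin.sum_univ_three, Matrix.one_apply] at h
    exact h
  have hJX : ∀ u ∈ U, ∀ m k, jacobian x u m k = pd k (X m) u := by
    intro u hu m k
    have hdx : DifferentiableAt ℝ x u := (hxu u hu).differentiableAt (by simp)
    have h := (hasFDerivAt_pi'.1 hdx.hasFDerivAt m).fderiv
    change fderiv ℝ x u (Pi.single k 1) m = fderiv ℝ (fun v => x v m) u (Pi.single k 1)
    rw [h]; rfl
  have hW : ∀ u ∈ U, ∀ i k, Wmat a x u i k = w i k u := by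
    intro u hu i k
    have : (a u)⁻¹ = (a u)ᵀ := Matrix.inv_eq_left_inv (hSO u hu).1
    rw [Wmat, this, Matrix.mul_apply, Fin.sum_univ_three, hJX u hu, hJX u hu, hJX u hu]
    rfl
  have hdet : ∀ u ∈ U, Upsilon.det3 (fun k => w 0 k u) (fun k => w 1 k u) (fun k => w 2 k u) ≠ 0 := by
    intro u hu
    have h : (Wmat a x u).det ≠ 0 := by
      have : (a u)⁻¹ = (a u)ᵀ := Matrix.inv_eq_left_inv (hSO u hu).1
      rw [Wmat, this, Matrix.det_mul, Matrix.det_transpose, (hSO u hu).2, one_mul]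
      exact (hJ u hu).ne_zero
    rw [Matrix.det_fin_three] at h
    simp only [hW u hu] at h
    intro h'
    apply h
    rw [← h', Upsilon.det3]; ring
  have hpd : ∀ u ∈ U, ∀ i j k, pd j (fun v => Wmat a x v i k) u = pd j (w i k) u :=
    fun u hu i j k => Upsilon.pd_congr hU hu (fun v hv => hW v hv i k) j
  have hc := Upsilon.core hU hX hb ho ho' w (fun _ _ => rfl) hdet
    (fun u hu j k => by
      have := h12 1 (Or.inl rfl) j k u hu
      rwa [hpd u hu, hpd u hu] at this)
    (fun u hu j k => by
      have := h12 2 (Or.inr rfl) j k u hu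
      rwa [hpd u hu, hpd u hu] at this)
    ![fun u => u 0, fun u => u 1, fun u => -2 * u 2]
    (fun u hu => by
      have := (hv u hu).1
      rwa [hpd u hu, hpd u hu] at this)
    (fun u hu => by
      have := (hv u hu).2.1
      rwa [hpd u hu, hpd u hu] at this)
    (fun u hu => by
      have := (hv u hu).2.2
      rwa [hpd u hu, hpd u hu] at this)
  have sw : ∀ i k, Upsilon.Sm (w i k) 0 := fun i k =>
    Upsilon.Sm.dt (hb 0 h0 i) (fun m => (hX 0 h0 m).pd k)
  have sc : ∀ i : Fin 3, Upsilon.Sm (fun u : Fin 3 → ℝ => u i) 0 := fun i => contDiffAt_apply ℝ ℝ i 0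
  let g : Fin 3 → (Fin 3 → ℝ) → ℝ := ![fun u => u 0, fun u => u 1, fun u => -2 * u 2]
  have sg : ∀ m, Upsilon.Sm (g m) 0 := by
    intro m
    fin_cases m
    · exact sc 0
    · exact sc 1
    · exact contDiffAt_const.mul (sc 2)
  have g2 : ∀ k, pd k (g 2) 0 = -2 * (if (2 : Fin 3) = k then 1 else 0) := by
    intro k
    change pd k (fun u : Fin 3 → ℝ => (fun _ => (-2 : ℝ)) u * (fun u => u 2) u) 0 = _
    rw [Upsilon.pd_mul contDiffAt_const (sc 2), Upsilon.pd_const, Upsilon.pd_coord]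
    ring
  have hz : ∀ k, pd k (Upsilon.dt (w 0) g) 0 = 0 := fun k =>
    (Upsilon.pd_congr hU h0 (g := fun _ => 0) (fun v hv => hc v hv) k).trans (Upsilon.pd_const _ _ _)
  have g0 : ∀ k, pd k (g 0) 0 = if (0 : Fin 3) = k then 1 else 0 := fun k => Upsilon.pd_coord 0 k 0
  have g1 : ∀ k, pd k (g 1) 0 = if (1 : Fin 3) = k then 1 else 0 := fun k => Upsilon.pd_coord 1 k 0
  have gz : ∀ m, g m 0 = 0 := by
    intro m; fin_cases m <;> simp [g]
  have w0 := hz 0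
  have w1 := hz 1
  have w2 := hz 2
  rw [Upsilon.pd_dt (sw 0) sg] at w0 w1 w2
  simp [Upsilon.dt, g0, g1, g2, gz, -Fin.isValue] at w0 w1 w2
  apply hdet 0 h0
  have e0 : w 0 0 0 = 0 := w0
  have e1 : w 0 1 0 = 0 := w1
  have e2 : w 0 2 0 = 0 := w2
  simp [Upsilon.det3, e0, e1, e2]
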